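/- Let φ₁, φ₂ be unit vectors in ℂ^d with ⟨φ₁, φ₂⟩ ≠ 0, and let Φ(ρ) = Σ_{k=1}^N p_k U_k ρ U_k* be a mixed unitary channel (p_k > 0, Σ p_k = 1, U_k unitary) that preserves the fidelity between φ₁ and φ₂, i.e. F(Φ(φ₁φ₁*), Φ(φ₂φ₂*)) = |⟨φ₁, φ₂⟩|. Then every local operation of Φ also preserves this fidelity: for every nonempty subset S of {1,…,N}, setting p_S = Σ_{k∈S} p_k and Φ_S(ρ) = Σ_{k∈S} (p_k/p_S) U_k ρ U_k*, one has F(Φ_S(φ₁φ₁*), Φ_S(φ₂φ₂*)) = |⟨φ₁, φ₂⟩|. -/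

import Mathlib

open Matrix ComplexOrder

/-- The positive semidefinite square root of a positive semidefinite matrix
(Mathlib's former `Matrix.PosSemidef.sqrt`, with its old definition). -/
noncomputable def Matrix.PosSemidef.sqrt {n 𝕜 : Type*} [Fintype n] [RCLike 𝕜] [DecidableEq n]
    {A : Matrix n n 𝕜} (hA : A.PosSemidef) : Matrix n n 𝕜 :=
  (hA.1.eigenvectorUnitary : Matrix n n 𝕜) *
    diagonal ((↑) ∘ Real.sqrt ∘ hA.1.eigenvalues) *
    (star hA.1.eigenvectorUnitary : Matrix n n 𝕜)

/-- The positive semidefinite square root of a matrix (junk value `0` if not PSD). -/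
noncomputable def psdSqrt {n : Type*} [Fintype n] [DecidableEq n]
    (A : Matrix n n ℂ) : Matrix n n ℂ :=
  letI := Classical.propDecidable A.PosSemidef
  if h : A.PosSemidef then h.sqrt else 0

/-- Fidelity `F(ρ,σ) = tr √(√σ ρ √σ)`. -/
noncomputable def fid {n : Type*} [Fintype n] [DecidableEq n]
    (ρ σ : Matrix n n ℂ) : ℝ :=
  (psdSqrt (psdSqrt σ * ρ * psdSqrt σ)).trace.re

/-- Trace norm `‖M‖₁ = tr √(M* M)`. -/
noncomputable def traceNorm {n : Type*} [Fintype n] [DecidableEq n]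
    (M : Matrix n n ℂ) : ℝ :=
  (psdSqrt (Mᴴ * M)).trace.re

/-- Inner product on `ℂ^ι`, conjugate-linear in the first argument. -/
noncomputable def cinner {ι : Type*} [Fintype ι] (x y : ι → ℂ) : ℂ := star x ⬝ᵥ y

/-- Rank-one density operator `φφ*` of a vector `φ`. -/
noncomputable def outer {ι : Type*} [Fintype ι] (φ : ι → ℂ) : Matrix ι ι ℂ :=
  vecMulVec φ (star φ)


lemma psdSqrt_spec {n : Type*} [Fintype n] [DecidableEq n] {A : Matrix n n ℂ}
    (h : A.PosSemidef) : (psdSqrt A).PosSemidef ∧ psdSqrt A * psdSqrt A = A := by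
  have e : psdSqrt A = h.sqrt := by simp [psdSqrt, h]
  rw [e]
  have hU : (star h.1.eigenvectorUnitary : Matrix n n ℂ) * (h.1.eigenvectorUnitary : Matrix n n ℂ) = 1 := by
    simp
  constructor
  · unfold Matrix.PosSemidef.sqrt
    have hd : (diagonal (((↑) : ℝ → ℂ) ∘ Real.sqrt ∘ h.1.eigenvalues)).PosSemidef := by
      apply PosSemidef.diagonal
      intro i
      simp [Real.sqrt_nonneg]
    have := hd.mul_mul_conjTranspose_same (h.1.eigenvectorUnitary : Matrix n n ℂ)
    exact this
  · conv_rhs => rw [h.1.spectral_theorem, Unitary.conjStarAlgAut_apply]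
    unfold Matrix.PosSemidef.sqrt
    have hd : diagonal (((↑) : ℝ → ℂ) ∘ Real.sqrt ∘ h.1.eigenvalues) *
        diagonal (((↑) : ℝ → ℂ) ∘ Real.sqrt ∘ h.1.eigenvalues) =
        diagonal (((↑) : ℝ → ℂ) ∘ h.1.eigenvalues) := by
      rw [diagonal_mul_diagonal]
      congr 1
      funext i
      simp only [Function.comp]
      rw [← Complex.ofReal_mul, Real.mul_self_sqrt (h.eigenvalues_nonneg i)]
    calc _ = (h.1.eigenvectorUnitary : Matrix n n ℂ) *
          (diagonal (((↑) : ℝ → ℂ) ∘ Real.sqrt ∘ h.1.eigenvalues) *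
          ((star h.1.eigenvectorUnitary : Matrix n n ℂ) * (h.1.eigenvectorUnitary : Matrix n n ℂ)) *
          diagonal (((↑) : ℝ → ℂ) ∘ Real.sqrt ∘ h.1.eigenvalues)) *
          (star h.1.eigenvectorUnitary : Matrix n n ℂ) := by
            simp only [Matrix.mul_assoc]; rfl
      _ = _ := by rw [hU, Matrix.mul_one, hd]; rfl

lemma exists_pinv {n : Type*} [Fintype n] [DecidableEq n] {P : Matrix n n ℂ}
    (h : P.IsHermitian) : ∃ Q : Matrix n n ℂ, Qᴴ = Q ∧ P * Q = Q * P ∧ P * Q * P = P ∧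
      Q * P * Q = Q := by
  obtain ⟨W, D, hW, hP⟩ : ∃ (W : Matrix n n ℂ) (D : n → ℝ), Wᴴ * W = 1 ∧
      P = W * diagonal (fun i => (D i : ℂ)) * Wᴴ := by
    refine ⟨h.eigenvectorUnitary, h.eigenvalues, ?_, ?_⟩
    · rw [← star_eq_conjTranspose]; simp
    · conv_lhs => rw [h.spectral_theorem, Unitary.conjStarAlgAut_apply]
      rfl
  have key : ∀ X Y : Matrix n n ℂ, (W * X * Wᴴ) * (W * Y * Wᴴ) = W * (X * Y) * Wᴴ := by
    intro X Y
    calc _ = W * X * (Wᴴ * W) * Y * Wᴴ := by simp only [Matrix.mul_assoc]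
      _ = _ := by rw [hW]; simp only [Matrix.mul_assoc, Matrix.one_mul]
  refine ⟨W * diagonal (fun i => ((D i)⁻¹ : ℂ)) * Wᴴ, ?_, ?_, ?_, ?_⟩
  · simp only [conjTranspose_mul, conjTranspose_conjTranspose, diagonal_conjTranspose, Matrix.mul_assoc]
    congr 3
    funext i
    simp
  all_goals
    subst hP
    simp only [key, diagonal_mul_diagonal]
    congr 3
    funext i
    by_cases hi : D i = 0
    · simp [hi]
    · have : (D i : ℂ) ≠ 0 := by exact_mod_cast hi
      field_simp

lemma polar {n m : Type*} [Fintype n] [DecidableEq n] [Fintype m] {P : Matrix n n ℂ}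
    (h : P.IsHermitian) (M : Matrix n m ℂ) (hM : M * Mᴴ = P * P) :
    ∃ V : Matrix n m ℂ, P * V = M ∧ M * Vᴴ = P ∧ V * Vᴴ * V = V ∧
      (1 - V * Vᴴ).PosSemidef := by
  obtain ⟨Q, hQ, hc, h1, h2⟩ := exists_pinv h
  have hE : (Q * M) * (Q * M)ᴴ = Q * P := by
    calc _ = Q * (M * Mᴴ) * Q := by simp only [conjTranspose_mul, hQ, Matrix.mul_assoc]
      _ = Q * (P * (P * Q)) := by rw [hM]; simp only [Matrix.mul_assoc]
      _ = Q * (P * Q * P) := by rw [Matrix.mul_assoc P Q P, ← hc]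
      _ = _ := by rw [h1]
  refine ⟨Q * M, ?_, ?_, ?_, ?_⟩
  · have hz : (P * (Q * M) - M) * (P * (Q * M) - M)ᴴ = 0 := by
      have : (P * (Q * M) - M) = (P * Q - 1) * M := by
        rw [Matrix.sub_mul, Matrix.one_mul, Matrix.mul_assoc]
      rw [this, conjTranspose_mul]
      calc _ = (P * Q - 1) * (M * Mᴴ) * (P * Q - 1)ᴴ := by simp only [Matrix.mul_assoc]
        _ = (P * Q * P - P) * P * (P * Q - 1)ᴴ := by
          rw [hM]; simp only [Matrix.sub_mul, Matrix.one_mul, Matrix.mul_assoc]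
        _ = 0 := by rw [h1]; simp
    exact sub_eq_zero.mp (self_mul_conjTranspose_eq_zero.mp hz)
  · calc _ = (M * Mᴴ) * Q := by simp only [conjTranspose_mul, hQ, Matrix.mul_assoc]
      _ = P * (P * Q) := by rw [hM]; simp only [Matrix.mul_assoc]
      _ = P * Q * P := by rw [Matrix.mul_assoc P Q P, ← hc]
      _ = _ := h1
  · rw [hE, ← Matrix.mul_assoc, h2]
  · rw [hE]
    have : 1 - Q * P = (1 - Q * P) * (1 - Q * P)ᴴ := by
      have e : (1 - Q * P)ᴴ = 1 - Q * P := by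
        rw [conjTranspose_sub, conjTranspose_mul, hQ, h.eq, hc, conjTranspose_one]
      rw [e, Matrix.sub_mul, Matrix.mul_sub, Matrix.mul_sub, ← Matrix.mul_assoc (Q * P) Q P, h2]
      simp
    rw [this]
    exact posSemidef_self_mul_conjTranspose _

/-- `t` is achieved as an overlap of purifications of `ρ`, `σ`. -/
def Ach {n : Type} [Fintype n] (ρ σ : Matrix n n ℂ) (t : ℝ) : Prop :=
  ∃ (m : Type) (_ : Fintype m) (A B : Matrix n m ℂ), A * Aᴴ = ρ ∧ B * Bᴴ = σ ∧
    (A * Bᴴ).trace.re = t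

lemma re_trace_le {n m : Type*} [Fintype n] [Fintype m] (X Y : Matrix n m ℂ) :
    2 * (X * Yᴴ).trace.re ≤ (X * Xᴴ).trace.re + (Y * Yᴴ).trace.re := by
  have h := (posSemidef_self_mul_conjTranspose (X - Y)).trace_nonneg
  have h' := (Complex.le_def.mp h).1
  have e : (Y * Xᴴ).trace.re = (X * Yᴴ).trace.re := by
    have : Y * Xᴴ = (X * Yᴴ)ᴴ := by simp
    rw [this, trace_conjTranspose]; simp
  simp only [conjTranspose_sub, Matrix.sub_mul, Matrix.mul_sub, trace_sub, Complex.sub_re,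
    Complex.zero_re] at h'
  linarith

lemma Ach.le_fid {n : Type} [Fintype n] [DecidableEq n] {ρ σ : Matrix n n ℂ} {t : ℝ}
    (h : Ach ρ σ t) : t ≤ fid ρ σ := by
  obtain ⟨m, _, A, B, hA, hB, rfl⟩ := h
  have hρ : ρ.PosSemidef := hA ▸ posSemidef_self_mul_conjTranspose A
  have hσ : σ.PosSemidef := hB ▸ posSemidef_self_mul_conjTranspose B
  unfold fid
  obtain ⟨hR, hRR⟩ := psdSqrt_spec hρ
  obtain ⟨hT, hTT⟩ := psdSqrt_spec hσ
  set R := psdSqrt ρ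
  set T := psdSqrt σ
  have hPP : (T * ρ * T).PosSemidef := by
    have := hρ.mul_mul_conjTranspose_same T
    rwa [hT.1.eq] at this
  obtain ⟨hP, hP2⟩ := psdSqrt_spec hPP
  set P := psdSqrt (T * ρ * T)
  obtain ⟨hS, hSS⟩ := psdSqrt_spec hP
  set S := psdSqrt P
  obtain ⟨C, hC, -, -, hC1⟩ := polar hR.1 A (by rw [hA, hRR])
  obtain ⟨D, hD, -, -, hD1⟩ := polar hT.1 B (by rw [hB, hTT])
  obtain ⟨V, hV, -, -, hV1⟩ := polar hP.1 (T * R) (by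
    rw [hP2, conjTranspose_mul, hR.1.eq, hT.1.eq, ← hRR]; simp only [Matrix.mul_assoc])
  have e1 : (A * Bᴴ).trace = ((S * V * C) * (S * D)ᴴ).trace := by
    calc (A * Bᴴ).trace = (R * C * Dᴴ * T).trace := by
          rw [← hC, ← hD, conjTranspose_mul, hT.1.eq]; simp only [Matrix.mul_assoc]
      _ = (T * R * C * Dᴴ).trace := by rw [trace_mul_comm]; simp only [Matrix.mul_assoc]
      _ = (S * (S * V * C * Dᴴ)).trace := by rw [← hV, ← hSS]; simp only [Matrix.mul_assoc]
      _ = _ := by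
        rw [trace_mul_comm, conjTranspose_mul, hS.1.eq]; simp only [Matrix.mul_assoc]
  have e2 : ((S * D) * (S * D)ᴴ).trace.re ≤ P.trace.re := by
    have := (hD1.mul_mul_conjTranspose_same S).trace_nonneg
    have := (Complex.le_def.mp this).1
    rw [hS.1.eq, Matrix.mul_sub, Matrix.sub_mul, Matrix.mul_one, hSS, trace_sub] at this
    rw [conjTranspose_mul, hS.1.eq]
    simp only [Matrix.mul_assoc, Complex.sub_re, Complex.zero_re] at this ⊢
    linarith
  have e3 : ((S * V * C) * (S * V * C)ᴴ).trace.re ≤ P.trace.re := by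
    have := (hV1.mul_mul_conjTranspose_same S).trace_nonneg
    have := (Complex.le_def.mp this).1
    have h2 := (hC1.mul_mul_conjTranspose_same (S * V)).trace_nonneg
    have h2 := (Complex.le_def.mp h2).1
    rw [hS.1.eq, Matrix.mul_sub, Matrix.sub_mul, Matrix.mul_one, hSS, trace_sub] at this
    rw [Matrix.mul_sub, Matrix.sub_mul, Matrix.mul_one, trace_sub] at h2
    simp only [conjTranspose_mul, hS.1.eq, Matrix.mul_assoc, Complex.sub_re, Complex.zero_re]
      at this h2 ⊢
    linarith
  have := re_trace_le (S * V * C) (S * D)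
  rw [e1]
  linarith

lemma Ach.add {n : Type} [Fintype n] {ρ σ ρ' σ' : Matrix n n ℂ} {t t' : ℝ}
    (h : Ach ρ σ t) (h' : Ach ρ' σ' t') : Ach (ρ + ρ') (σ + σ') (t + t') := by
  obtain ⟨m, _, A, B, rfl, rfl, rfl⟩ := h
  obtain ⟨m', _, A', B', rfl, rfl, rfl⟩ := h'
  refine ⟨m ⊕ m', inferInstance, fromCols A A', fromCols B B', ?_, ?_, ?_⟩ <;>
  simp [conjTranspose_fromCols_eq_fromRows_conjTranspose, fromCols_mul_fromRows]

lemma Ach.smul {n : Type} [Fintype n] {ρ σ : Matrix n n ℂ} {t : ℝ}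
    (h : Ach ρ σ t) {c : ℝ} (hc : 0 ≤ c) : Ach ((c : ℂ) • ρ) ((c : ℂ) • σ) (c * t) := by
  obtain ⟨m, _, A, B, rfl, rfl, rfl⟩ := h
  have e : ((√c : ℝ) : ℂ) * ((√c : ℝ) : ℂ) = c := by
    rw [← Complex.ofReal_mul, Real.mul_self_sqrt hc]
  refine ⟨m, inferInstance, ((√c : ℝ) : ℂ) • A, ((√c : ℝ) : ℂ) • B, ?_, ?_, ?_⟩ <;>
  simp [conjTranspose_smul, smul_smul, e, -Complex.coe_smul, trace_smul]

lemma Ach.zero {n : Type} [Fintype n] : Ach (0 : Matrix n n ℂ) 0 0 :=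
  ⟨Unit, inferInstance, 0, 0, by simp, by simp, by simp⟩

lemma Ach.sum {n ι : Type} [Fintype n] (S : Finset ι) (ρ σ : ι → Matrix n n ℂ) (t : ι → ℝ)
    (h : ∀ k, Ach (ρ k) (σ k) (t k)) : Ach (∑ k ∈ S, ρ k) (∑ k ∈ S, σ k) (∑ k ∈ S, t k) := by
  classical
  induction S using Finset.induction_on with
  | empty => simpa using Ach.zero
  | insert a s ha ih =>
    rw [Finset.sum_insert ha, Finset.sum_insert ha, Finset.sum_insert ha]
    exact (h a).add ih

lemma ach_fid {n : Type} [Fintype n] [DecidableEq n] {ρ σ : Matrix n n ℂ}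
    (hρ : ρ.PosSemidef) (hσ : σ.PosSemidef) : Ach ρ σ (fid ρ σ) := by
  unfold fid
  obtain ⟨hR, hRR⟩ := psdSqrt_spec hρ
  obtain ⟨hT, hTT⟩ := psdSqrt_spec hσ
  set R := psdSqrt ρ
  set T := psdSqrt σ
  have hPP : (T * ρ * T).PosSemidef := by
    have := hρ.mul_mul_conjTranspose_same T
    rwa [hT.1.eq] at this
  obtain ⟨hP, hP2⟩ := psdSqrt_spec hPP
  set P := psdSqrt (T * ρ * T)
  obtain ⟨V, hV, hV2, hV3, -⟩ := polar hP.1 (T * R) (by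
    rw [hP2, conjTranspose_mul, hR.1.eq, hT.1.eq, ← hRR]; simp only [Matrix.mul_assoc])
  have hG : (1 - Vᴴ * V) * (1 - Vᴴ * V) = 1 - Vᴴ * V := by
    have : Vᴴ * V * (Vᴴ * V) = Vᴴ * V := by
      rw [Matrix.mul_assoc, ← Matrix.mul_assoc V, hV3]
    rw [Matrix.sub_mul, Matrix.mul_sub, Matrix.mul_sub, this]; simp
  refine ⟨n ⊕ n, inferInstance, fromCols (R * Vᴴ) (R * (1 - Vᴴ * V)), fromCols T 0, ?_, ?_, ?_⟩
  · rw [conjTranspose_fromCols_eq_fromRows_conjTranspose, fromCols_mul_fromRows]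
    have e : (1 - Vᴴ * V)ᴴ = 1 - Vᴴ * V := by simp
    calc _ = R * (Vᴴ * V) * R + R * ((1 - Vᴴ * V) * (1 - Vᴴ * V)) * R := by
          simp only [conjTranspose_mul _ (_ - _), e]
          simp only [conjTranspose_mul, conjTranspose_conjTranspose, hR.1.eq, Matrix.mul_assoc]
      _ = R * R := by rw [hG, Matrix.mul_sub, Matrix.sub_mul]; simp
      _ = ρ := hRR
  · simp [conjTranspose_fromCols_eq_fromRows_conjTranspose, fromCols_mul_fromRows, hT.1.eq, hTT]
  · rw [conjTranspose_fromCols_eq_fromRows_conjTranspose, fromCols_mul_fromRows]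
    simp only [conjTranspose_zero, Matrix.mul_zero, add_zero, hT.1.eq]
    rw [trace_mul_comm, ← Matrix.mul_assoc, hV2]

lemma ach_pure {n : Type} [Fintype n] [DecidableEq n] (x y : n → ℂ) (hne : cinner x y ≠ 0)
    (U : Matrix n n ℂ) (hU : Uᴴ * U = 1) :
    Ach (U * outer x * Uᴴ) (U * outer y * Uᴴ) ‖cinner x y‖ := by
  set z := cinner x y with hz
  have hn : (‖z‖ : ℂ) ≠ 0 := by exact_mod_cast norm_ne_zero_iff.mpr hne
  have hzz : star z * z = (‖z‖ : ℂ) * ‖z‖ := by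
    have := Complex.conj_mul' z
    rw [sq] at this; exact this
  set c : ℂ := star z / ‖z‖ with hcdef
  have hsc : star c = z / ‖z‖ := by simp [hcdef]
  have hc : c * star c = 1 := by
    rw [hsc, hcdef, div_mul_div_comm, hzz, div_self (mul_ne_zero hn hn)]
  have ho : ∀ v w : n → ℂ, replicateCol Unit v * (replicateCol Unit w)ᴴ = vecMulVec v (star w) := by
    intro v w
    rw [conjTranspose_replicateCol, vecMulVec_eq Unit]
  refine ⟨Unit, inferInstance, U * replicateCol Unit x, c • (U * replicateCol Unit y), ?_, ?_, ?_⟩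
  · rw [outer, ← ho]; simp only [conjTranspose_mul, Matrix.mul_assoc]
  · rw [outer, ← ho, conjTranspose_smul, Matrix.smul_mul, Matrix.mul_smul, smul_smul, hc, one_smul]
    simp only [conjTranspose_mul, Matrix.mul_assoc]
  · have : (U * replicateCol Unit x * (c • (U * replicateCol Unit y))ᴴ).trace = (‖z‖ : ℂ) := by
      rw [conjTranspose_smul, Matrix.mul_smul, trace_smul]
      have e : (U * replicateCol Unit x * (U * replicateCol Unit y)ᴴ).trace = star z := by
        calc _ = (U * (replicateCol Unit x * (replicateCol Unit y)ᴴ * Uᴴ)).trace := by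
              simp only [conjTranspose_mul, Matrix.mul_assoc]
          _ = (replicateCol Unit x * (replicateCol Unit y)ᴴ).trace := by
              rw [trace_mul_comm, Matrix.mul_assoc, hU, Matrix.mul_one]
          _ = star z := by
              rw [ho, trace_vecMulVec, hz, cinner, star_dotProduct, star_star, dotProduct_comm]
      rw [e, hsc, smul_eq_mul, div_mul_eq_mul_div, mul_comm, hzz, mul_div_assoc, div_self hn, mul_one]
    rw [this]; simp

theorem stmt11 (d : ℕ) (φ₁ φ₂ : Fin d → ℂ)
    (hφ₁ : cinner φ₁ φ₁ = 1) (hφ₂ : cinner φ₂ φ₂ = 1) (hne : cinner φ₁ φ₂ ≠ 0)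
    (N : ℕ) (hN : 1 ≤ N) (p : Fin N → ℝ) (hp : ∀ k, 0 < p k) (hpsum : ∑ k, p k = 1)
    (U : Fin N → Matrix (Fin d) (Fin d) ℂ) (hU : ∀ k, (U k)ᴴ * U k = 1)
    (hpres : fid (∑ k, (p k : ℂ) • (U k * outer φ₁ * (U k)ᴴ))
        (∑ k, (p k : ℂ) • (U k * outer φ₂ * (U k)ᴴ)) = ‖cinner φ₁ φ₂‖)
    (S : Finset (Fin N)) (hS : S.Nonempty) :
    fid (∑ k ∈ S, ((p k / ∑ j ∈ S, p j : ℝ) : ℂ) • (U k * outer φ₁ * (U k)ᴴ))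
        (∑ k ∈ S, ((p k / ∑ j ∈ S, p j : ℝ) : ℂ) • (U k * outer φ₂ * (U k)ᴴ)) =
      ‖cinner φ₁ φ₂‖ := by
  have hpure : ∀ k, Ach (U k * outer φ₁ * (U k)ᴴ) (U k * outer φ₂ * (U k)ᴴ) ‖cinner φ₁ φ₂‖ :=
    fun k => ach_pure φ₁ φ₂ hne (U k) (hU k)
  set f : ℝ := ‖cinner φ₁ φ₂‖
  set P : ℝ := ∑ j ∈ S, p j with hP
  have hPpos : 0 < P := Finset.sum_pos (fun k _ => hp k) hS
  have hPc : (P : ℂ) ≠ 0 := by exact_mod_cast hPpos.ne'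
  have hlow := Ach.sum S _ _ _ (fun k => (hpure k).smul (div_nonneg (hp k).le hPpos.le))
  have hsum : ∑ k ∈ S, p k / P * f = f := by
    rw [← Finset.sum_mul, ← Finset.sum_div, ← hP, div_self hPpos.ne', one_mul]
  rw [hsum] at hlow
  have hge := hlow.le_fid
  have hpsd : (∑ k ∈ S, ((p k / P : ℝ) : ℂ) • (U k * outer φ₁ * (U k)ᴴ)).PosSemidef ∧
      (∑ k ∈ S, ((p k / P : ℝ) : ℂ) • (U k * outer φ₂ * (U k)ᴴ)).PosSemidef := by
    obtain ⟨m, _, A, B, hA, hB, -⟩ := hlow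
    exact ⟨hA ▸ posSemidef_self_mul_conjTranspose A, hB ▸ posSemidef_self_mul_conjTranspose B⟩
  have hbig := ((ach_fid hpsd.1 hpsd.2).smul hPpos.le).add
    (Ach.sum Sᶜ _ _ _ (fun k => (hpure k).smul (hp k).le))
  have hre : ∀ X : Fin N → Matrix (Fin d) (Fin d) ℂ,
      (P : ℂ) • (∑ k ∈ S, ((p k / P : ℝ) : ℂ) • X k) + ∑ k ∈ Sᶜ, (p k : ℂ) • X k =
        ∑ k, (p k : ℂ) • X k := by
    intro X
    rw [← Finset.sum_add_sum_compl S, Finset.smul_sum]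
    congr 1
    refine Finset.sum_congr rfl fun k _ => ?_
    rw [smul_smul]
    congr 1
    push_cast
    field_simp
  rw [hre, hre] at hbig
  have hle := hbig.le_fid
  rw [hpres, ← Finset.sum_mul] at hle
  have hc : ∑ k ∈ Sᶜ, p k = 1 - P := by
    rw [← hpsum, ← Finset.sum_add_sum_compl S p]; ring
  rw [hc] at hle
  refine le_antisymm ?_ hge
  have : P * fid (∑ k ∈ S, ((p k / P : ℝ) : ℂ) • (U k * outer φ₁ * (U k)ᴴ))
        (∑ k ∈ S, ((p k / P : ℝ) : ℂ) • (U k * outer φ₂ * (U k)ᴴ)) ≤ P * f := by linarith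
  exact le_of_mul_le_mul_left this hPpos
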